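/- Let b ≥ 2 and g ≥ 1 be integers with gcd(g, b) = 1, and let T_g^b = { k ≥ 1 : gcd((b^k − 1)/(b − 1), k) = g }. Then the series ∑_{d ≥ 1, gcd(d,b) = 1} μ(d)/L_b(dg) converges absolutely, T_g^b has a natural density, and d(T_g^b) = lim_{x→∞} #{ k ∈ T_g^b : k ≤ x } / x = ∑_{d ≥ 1, gcd(d,b) = 1} μ(d)/L_b(dg), where μ is the Möbius function, L_b(x) = lcm(x, ord_x(b)), and ord_x(b) is the multiplicative order of b modulo x. -/

import Mathlib

open Filter

/-- geometric sum splitting -/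
lemma geom_split (b p m : ℕ) :
    ∑ i ∈ Finset.range (p * m), b ^ i =
      (∑ i ∈ Finset.range p, b ^ i) * ∑ j ∈ Finset.range m, (b ^ p) ^ j := by
  induction m with
  | zero => simp
  | succ m ih =>
    rw [Nat.mul_succ, Finset.sum_range_add, ih, Finset.sum_range_succ, mul_add]
    congr 1
    rw [Finset.sum_mul]
    apply Finset.sum_congr rfl
    intro i _
    rw [pow_add, pow_mul, mul_comm]

lemma pow_dvd_geom (p : ℕ) (a : ℕ) : ∀ (b k : ℕ), b ≡ 1 [MOD p] → p ^ a ∣ k →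
    p ^ a ∣ ∑ i ∈ Finset.range k, b ^ i := by
  induction a with
  | zero => intro b k _ _; simp
  | succ a ih =>
    intro b k hb hk
    obtain ⟨c, rfl⟩ := hk
    rw [pow_succ', mul_assoc, geom_split]
    apply mul_dvd_mul
    · rw [← Nat.modEq_zero_iff_dvd]
      have h1 : ∑ i ∈ Finset.range p, b ^ i ≡ ∑ i ∈ Finset.range p, 1 [MOD p] := by
        rw [← ZMod.natCast_eq_natCast_iff] at hb ⊢
        push_cast at hb ⊢
        simp [hb]
      refine h1.trans ?_
      simp
    · apply ih
      · simpa using hb.pow p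
      · exact dvd_mul_right _ _

lemma dvd_geom_iff (b x k : ℕ) (hb : 2 ≤ b) (hk : 1 ≤ k) :
    x ∣ Nat.gcd ((b ^ k - 1) / (b - 1)) k ↔
      Nat.Coprime x b ∧ Nat.lcm x (orderOf (b : ZMod x)) ∣ k := by
  rw [← Nat.geomSum_eq hb]
  have hmul : (∑ i ∈ Finset.range k, b ^ i) * (b - 1) = b ^ k - 1 := by
    have := Nat.geomSum_eq hb k
    have h2 : (b - 1) ∣ b ^ k - 1 := by simpa using Nat.sub_dvd_pow_sub_pow b 1 k
    rw [this, Nat.div_mul_cancel h2]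
  have hpos : 1 ≤ b ^ k := Nat.one_le_pow _ _ (by omega)
  have key : orderOf (b : ZMod x) ∣ k ↔ x ∣ b ^ k - 1 := by
    rw [orderOf_dvd_iff_pow_eq_one, ← Nat.modEq_iff_dvd' hpos, ← ZMod.natCast_eq_natCast_iff]
    push_cast
    exact eq_comm
  rw [Nat.dvd_gcd_iff, Nat.lcm_dvd_iff, key]
  constructor
  · rintro ⟨h1, h2⟩
    have h3 : x ∣ b ^ k - 1 := hmul ▸ h1.mul_right _
    refine ⟨?_, h2, h3⟩
    have h4 : Nat.Coprime (b ^ k - 1) (b ^ k) := by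
      rw [Nat.coprime_comm]
      exact (Nat.coprime_self_sub_right hpos).2 (by simp)
    exact (h4.coprime_dvd_left h3).coprime_dvd_right (dvd_pow_self b (by omega))
  · rintro ⟨h1, h2, h3⟩
    refine ⟨?_, h2⟩
    rw [Nat.dvd_iff_prime_pow_dvd_dvd]
    intro p a hp hpa
    by_cases hpb : p ∣ b - 1
    · apply pow_dvd_geom p a b k _ (hpa.trans h2)
      exact ((Nat.modEq_iff_dvd' (by omega)).2 hpb).symm
    · have := hpa.trans h3
      rw [← hmul] at this
      exact Nat.Coprime.dvd_of_dvd_mul_right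
        (Nat.Coprime.pow_left a ((Nat.Prime.coprime_iff_not_dvd hp).2 hpb)) this

lemma moebius_sum (n : ℕ) :
    ∑ d ∈ n.divisors, ArithmeticFunction.moebius d = if n = 1 then 1 else 0 := by
  have := congrArg (fun f => f n) ArithmeticFunction.moebius_mul_coe_zeta
  simp only [ArithmeticFunction.one_apply] at this
  rw [← this]
  exact (ArithmeticFunction.coe_mul_zeta_apply).symm

lemma indicator_sum (b g k N : ℕ) (hb : 2 ≤ b) (hg : 1 ≤ g) (hk : 1 ≤ k) (hkN : k ≤ N) :
    (if Nat.gcd ((b ^ k - 1) / (b - 1)) k = g then (1 : ℤ) else 0) =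
     ∑ d ∈ Finset.range (N + 1), if (1 ≤ d ∧ Nat.Coprime (d * g) b ∧
      Nat.lcm (d * g) (orderOf (b : ZMod (d * g))) ∣ k) then ArithmeticFunction.moebius d else 0 := by
  simp_rw [← dvd_geom_iff b _ k hb hk]
  set G := Nat.gcd ((b ^ k - 1) / (b - 1)) k with hG
  have hGpos : 0 < G := Nat.gcd_pos_of_pos_right _ hk
  have hGk : G ≤ k := Nat.gcd_le_right _ hk
  rw [← Finset.sum_filter]
  by_cases hgG : g ∣ G
  · obtain ⟨c, hc⟩ := hgG
    have hc1 : 1 ≤ c := by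
      rcases Nat.eq_zero_or_pos c with h | h
      · subst h; omega
      · exact h
    have : (Finset.range (N + 1)).filter (fun d => 1 ≤ d ∧ d * g ∣ G) = c.divisors := by
      ext d
      simp only [Finset.mem_filter, Finset.mem_range, Nat.mem_divisors]
      rw [hc, mul_comm d g, Nat.mul_dvd_mul_iff_left (by omega)]
      constructor
      · rintro ⟨_, _, h⟩; exact ⟨h, by omega⟩
      · rintro ⟨h, _⟩
        have h1 := Nat.le_of_dvd hc1 h
        have h2 := Nat.pos_of_dvd_of_pos h hc1
        have : c ≤ g * c := Nat.le_mul_of_pos_left _ hg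
        exact ⟨by omega, h2, h⟩
    rw [this, moebius_sum c, hc]
    congr 1
    simp only [eq_iff_iff]
    constructor
    · intro h; exact Nat.eq_of_mul_eq_mul_left hg (by omega)
    · rintro rfl; simp
  · rw [if_neg (fun h : G = g => hgG h.symm.dvd)]
    symm
    apply Finset.sum_eq_zero
    intro d hd
    simp only [Finset.mem_filter] at hd
    exact absurd ((dvd_mul_left g d).trans hd.2.2) hgG

lemma count_eq (b g N : ℕ) (hb : 2 ≤ b) (hg : 1 ≤ g) (hcop : Nat.Coprime g b) :
    (((Finset.Icc 1 N).filter
              (fun k => Nat.gcd ((b ^ k - 1) / (b - 1)) k = g)).card : ℤ) =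
    ∑ d ∈ Finset.range (N + 1), if 1 ≤ d ∧ Nat.Coprime d b then
      ArithmeticFunction.moebius d * ((N / Nat.lcm (d * g) (orderOf (b : ZMod (d * g))) : ℕ) : ℤ)
      else 0 := by
  rw [Finset.card_filter]
  push_cast
  rw [Finset.sum_congr rfl (fun k hk => indicator_sum b g k N hb hg (Finset.mem_Icc.1 hk).1
    (Finset.mem_Icc.1 hk).2), Finset.sum_comm]
  apply Finset.sum_congr rfl
  intro d _
  by_cases h : 1 ≤ d ∧ Nat.Coprime d b
  · have h' : Nat.Coprime (d * g) b := Nat.Coprime.mul_left h.2 hcop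
    have hiff : ∀ k : ℕ, (1 ≤ d ∧ Nat.Coprime (d * g) b ∧
        Nat.lcm (d * g) (orderOf (b : ZMod (d * g))) ∣ k) ↔
        Nat.lcm (d * g) (orderOf (b : ZMod (d * g))) ∣ k :=
      fun k => ⟨fun hh => hh.2.2, fun hh => ⟨h.1, h', hh⟩⟩
    rw [if_pos h]
    simp_rw [hiff]
    rw [← Int.natCast_div, ← Nat.Ioc_filter_dvd_card_eq_div, ← Finset.sum_filter, Finset.sum_const, nsmul_eq_mul,
      mul_comm]
    rfl
  · rw [if_neg h]
    apply Finset.sum_eq_zero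
    intro k _
    rw [if_neg]
    rintro ⟨h1, h2, _⟩
    exact h ⟨h1, Nat.Coprime.coprime_mul_right h2⟩

lemma card_div_le (t : ℕ) : ((t.divisors.card : ℕ) : ℝ) ≤ 2 * Real.sqrt t := by
  have h : t.divisors ⊆ Finset.Icc 1 (Nat.sqrt t) ∪ (Finset.Icc 1 (Nat.sqrt t)).image (t / ·) := by
    intro d hd
    rw [Nat.mem_divisors] at hd
    obtain ⟨⟨c, hc⟩, ht⟩ := hd
    have hd0 : 0 < d := Nat.pos_of_ne_zero (by rintro rfl; simp at hc; exact ht hc)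
    have hc0 : 0 < c := Nat.pos_of_ne_zero (by rintro rfl; simp at hc; exact ht hc)
    rw [Finset.mem_union, Finset.mem_image]
    by_cases hdc : d ≤ c
    · left
      rw [Finset.mem_Icc]
      exact ⟨hd0, Nat.le_sqrt.2 (by rw [hc]; exact Nat.mul_le_mul_left _ hdc)⟩
    · right
      refine ⟨c, ?_, ?_⟩
      · rw [Finset.mem_Icc]
        exact ⟨hc0, Nat.le_sqrt.2 (by rw [hc]; exact Nat.mul_le_mul_right _ (by omega))⟩
      · rw [hc, Nat.mul_div_cancel _ hc0]
  have h1 := (Finset.card_le_card h).trans (Finset.card_union_le _ _)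
  have h2 : ((Finset.Icc 1 (Nat.sqrt t)).image (t / ·)).card ≤ Nat.sqrt t := by
    refine Finset.card_image_le.trans ?_
    simp
  simp only [Nat.card_Icc, Nat.add_sub_cancel] at h1
  have h3 : t.divisors.card ≤ 2 * Nat.sqrt t := by omega
  have h4 : ((t.divisors.card : ℕ) : ℝ) ≤ 2 * (Nat.sqrt t : ℝ) := by exact_mod_cast h3
  have := Real.nat_sqrt_le_real_sqrt (a := t)
  linarith

lemma sum_log_div (n : ℕ) (hn : 1 ≤ n) :
    ∑ p ∈ Nat.primesLE n, Real.log p / p ≤ 2 * Real.log n := by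
  have hd : ∏ p ∈ Nat.primesLE n, p ^ (n / p) ∣ n.factorial := by
    apply Finset.prod_dvd_of_isRelPrime
    · intro p hp q hq hpq
      have hp' : p.Prime := (Nat.mem_primesLE.1 hp).2
      have hq' : q.Prime := (Nat.mem_primesLE.1 hq).2
      exact Nat.coprime_iff_isRelPrime.1 (((Nat.coprime_primes hp' hq').2 hpq).pow _ _)
    · intro p hp
      have hp' : p.Prime := (Nat.mem_primesLE.1 hp).2
      have hpn : p ≤ n := (Nat.mem_primesLE.1 hp).1
      rw [hp'.pow_dvd_factorial_iff (Nat.lt_succ_self _)]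
      have hl : 1 ≤ Nat.log p n := Nat.log_pos hp'.one_lt hpn
      have := Finset.single_le_sum (f := fun i => n / p ^ i) (s := Finset.Ico 1 (Nat.log p n).succ)
        (fun _ _ => Nat.zero_le _) (a := 1) (by rw [Finset.mem_Ico]; omega)
      simpa using this
  have hle : ∏ p ∈ Nat.primesLE n, p ^ (n / p) ≤ n ^ n :=
    (Nat.le_of_dvd (Nat.factorial_pos _) hd).trans (Nat.factorial_le_pow n)
  have hpos : 0 < ∏ p ∈ Nat.primesLE n, p ^ (n / p) :=
    Finset.prod_pos fun p hp => pow_pos (Nat.mem_primesLE.1 hp).2.pos _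
  have hlog := Real.log_le_log (by exact_mod_cast hpos)
    (show ((∏ p ∈ Nat.primesLE n, p ^ (n / p) : ℕ) : ℝ) ≤ ((n ^ n : ℕ) : ℝ) by exact_mod_cast hle)
  push_cast at hlog
  rw [Real.log_pow, Real.log_prod (fun p hp => pow_ne_zero _
    (by exact_mod_cast (Nat.mem_primesLE.1 hp).2.ne_zero))] at hlog
  simp_rw [Real.log_pow] at hlog
  have hn' : (0 : ℝ) < n := by exact_mod_cast hn
  have : (n : ℝ) * ∑ p ∈ Nat.primesLE n, Real.log p / p ≤
      2 * ∑ p ∈ Nat.primesLE n, ((n / p : ℕ) : ℝ) * Real.log p := by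
    rw [Finset.mul_sum, Finset.mul_sum]
    apply Finset.sum_le_sum
    intro p hp
    have hp' : p.Prime := (Nat.mem_primesLE.1 hp).2
    have hpn : p ≤ n := (Nat.mem_primesLE.1 hp).1
    have hp0 : (0 : ℝ) < p := by exact_mod_cast hp'.pos
    have h1 : 1 ≤ n / p := Nat.div_pos hpn hp'.pos
    have h2 : n < p * (n / p + 1) := Nat.lt_mul_div_succ n hp'.pos
    have h3 : n ≤ p * (2 * (n / p)) := h2.le.trans (Nat.mul_le_mul_left _ (by omega))
    have h4 : (n : ℝ) ≤ p * (2 * ((n / p : ℕ) : ℝ)) := by exact_mod_cast h3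
    have h5 : (n : ℝ) / p ≤ 2 * ((n / p : ℕ) : ℝ) := by
      rw [div_le_iff₀ hp0]; linarith
    have h6 : 0 ≤ Real.log p := Real.log_natCast_nonneg p
    calc (n : ℝ) * (Real.log p / p) = n / p * Real.log p := by ring
      _ ≤ _ := by
        rw [← mul_assoc]
        exact mul_le_mul_of_nonneg_right h5 h6
  have h7 : (n : ℝ) * ∑ p ∈ Nat.primesLE n, Real.log p / p ≤ n * (2 * Real.log n) := by linarith
  exact le_of_mul_le_mul_left h7 hn'

lemma sum_inv_primes : ∃ K : ℝ, ∀ n : ℕ, 1 ≤ n →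
    ∑ p ∈ Nat.primesLE n, (p : ℝ)⁻¹ ≤ K + Real.log n / 8 := by
  obtain ⟨K, hK⟩ := exists_nat_ge (Real.exp 16)
  refine ⟨K, fun n hn => ?_⟩
  have h1 : ∀ p ∈ Nat.primesLE n, (p : ℝ)⁻¹ ≤ (if p < K then 1 else 0) + Real.log p / p / 16 := by
    intro p hp
    have hp' : p.Prime := (Nat.mem_primesLE.1 hp).2
    have hp0 : (1 : ℝ) ≤ p := by exact_mod_cast hp'.one_lt.le
    have h6 : 0 ≤ Real.log p := Real.log_natCast_nonneg p
    split_ifs with h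
    · have : (p : ℝ)⁻¹ ≤ 1 := inv_le_one_of_one_le₀ hp0
      have : 0 ≤ Real.log p / p / 16 := by positivity
      linarith
    · have h2 : Real.exp 16 ≤ p := hK.trans (by exact_mod_cast not_lt.1 h)
      have h3 : 16 ≤ Real.log p := by
        rw [Real.le_log_iff_exp_le (by linarith)]; exact h2
      rw [zero_add, inv_eq_one_div, div_div, mul_comm, ← div_div, div_le_div_iff_of_pos_right (by linarith)] 
      linarith
  refine (Finset.sum_le_sum h1).trans ?_
  rw [Finset.sum_add_distrib, ← Finset.sum_div]
  have h2 := sum_log_div n hn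
  have h3 : ∑ p ∈ Nat.primesLE n, (if p < K then (1 : ℝ) else 0) ≤ K := by
    rw [← Finset.sum_filter, Finset.sum_const, nsmul_eq_mul, mul_one]
    have : ((Nat.primesLE n).filter (· < K)) ⊆ Finset.range K := by
      intro p hp; simp at hp ⊢; exact hp.2
    have := Finset.card_le_card this
    rw [Finset.card_range] at this
    exact_mod_cast this
  linarith

lemma sum_inv_divisors : ∃ C : ℝ, 0 < C ∧ ∀ n : ℕ, 1 ≤ n →
    ∑ c ∈ (primorial n).divisors, (c : ℝ)⁻¹ ≤ C * (n : ℝ) ^ (1 / 8 : ℝ) := by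
  obtain ⟨K, hK⟩ := sum_inv_primes
  refine ⟨Real.exp K, Real.exp_pos _, fun n hn => ?_⟩
  let f : ArithmeticFunction ℝ := ⟨fun c => (c : ℝ)⁻¹, by simp⟩
  have hf : f.IsMultiplicative := by
    rw [ArithmeticFunction.IsMultiplicative.iff_ne_zero]
    refine ⟨by simp [f], ?_⟩
    intro m n _ _ _
    simp [f, mul_comm]
  have := hf.prodPrimeFactors_one_add_of_squarefree (squarefree_primorial n)
  change _ = ∑ c ∈ (primorial n).divisors, (c : ℝ)⁻¹ at this
  rw [← this, primeFactors_primorial]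
  have hn' : (0 : ℝ) < n := by exact_mod_cast hn
  calc ∏ p ∈ Nat.primesLE n, (1 + f p) ≤ ∏ p ∈ Nat.primesLE n, Real.exp ((p : ℝ)⁻¹) := by
        apply Finset.prod_le_prod
        · intro p _
          change 0 ≤ 1 + (p : ℝ)⁻¹
          positivity
        · intro p _
          change 1 + (p : ℝ)⁻¹ ≤ _
          rw [add_comm]
          exact Real.add_one_le_exp _
    _ = Real.exp (∑ p ∈ Nat.primesLE n, (p : ℝ)⁻¹) := (Real.exp_sum _ _).symm
    _ ≤ Real.exp (K + Real.log n / 8) := Real.exp_le_exp.2 (hK n hn)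
    _ = _ := by
      rw [Real.exp_add, Real.rpow_def_of_pos hn']
      congr 2
      ring

lemma sum_quot (s T : Finset ℕ) (a : ℕ) (h : ℕ → ℝ) (h0 : ∀ x, 0 ≤ h x)
    (hs : ∀ x ∈ s, a ∣ x ∧ x / a ∈ T) : ∑ x ∈ s, h (x / a) ≤ ∑ c ∈ T, h c := by
  have hinj : Set.InjOn (fun x => x / a) (s : Set ℕ) := by
    intro x hx y hy hxy
    simp only at hxy
    rw [← Nat.div_mul_cancel (hs x hx).1, ← Nat.div_mul_cancel (hs y hy).1, hxy]
  rw [← Finset.sum_image (f := h) (g := fun x => x / a) hinj]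
  apply Finset.sum_le_sum_of_subset_of_nonneg
  · intro c hc
    obtain ⟨x, hx, rfl⟩ := Finset.mem_image.1 hc
    exact (hs x hx).2
  · intro i _ _; exact h0 i

lemma ord_pos (b x : ℕ) (hx : 1 ≤ x) (h : Nat.Coprime x b) : 0 < orderOf (b : ZMod x) := by
  have : NeZero x := ⟨by omega⟩
  have : (b : ZMod x) = ((ZMod.unitOfCoprime b h.symm : (ZMod x)ˣ) : ZMod x) := by simp
  rw [this, orderOf_units]
  exact orderOf_pos _

lemma ord_dvd (b x y : ℕ) (h : x ∣ y) : orderOf (b : ZMod x) ∣ orderOf (b : ZMod y) := by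
  have := orderOf_map_dvd (ZMod.castHom h (ZMod x) : ZMod y →* ZMod x) (b : ZMod y)
  simpa using this

lemma card_fiber (b t : ℕ) (hb : 2 ≤ b) (ht : 1 ≤ t) (S : Finset ℕ)
    (hS : ∀ p ∈ S, p.Prime ∧ orderOf (b : ZMod p) = t) : S.card ≤ b * t := by
  have hpos : 1 ≤ b ^ t := Nat.one_le_pow _ _ (by omega)
  have h2 : 1 < b ^ t := Nat.one_lt_pow (by omega) (by omega)
  have hd : ∏ p ∈ S, p ∣ b ^ t - 1 := by
    apply Finset.prod_primes_dvd
    · intro p hp; exact (hS p hp).1.prime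
    · intro p hp
      have : (b : ZMod p) ^ t = 1 := by rw [← (hS p hp).2]; exact pow_orderOf_eq_one _
      rw [← Nat.modEq_iff_dvd' hpos, ← ZMod.natCast_eq_natCast_iff]
      push_cast
      exact this.symm
  have h3 := Nat.le_of_dvd (by omega) hd
  have h4 : 2 ^ S.card ≤ ∏ p ∈ S, p := by
    apply Finset.pow_card_le_prod
    intro p hp; exact (hS p hp).1.two_le
  have h5 : b ^ t ≤ 2 ^ (b * t) := by
    rw [pow_mul]; exact Nat.pow_le_pow_left (Nat.lt_two_pow_self).le _
  exact (Nat.pow_le_pow_iff_right (by norm_num : 1 < 2)).1 (h4.trans (by omega))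

lemma sum_ord (b : ℕ) (hb : 2 ≤ b) : ∃ C : ℝ, ∀ S : Finset ℕ,
    (∀ p ∈ S, p.Prime ∧ Nat.Coprime p b) →
    ∑ p ∈ S, (orderOf (b : ZMod p) : ℝ) ^ (-(9 / 4) : ℝ) ≤ C := by
  have hsum : Summable (fun t : ℕ => (t : ℝ) ^ (-(5 / 4) : ℝ)) :=
    Real.summable_nat_rpow.2 (by norm_num)
  refine ⟨b * ∑' t : ℕ, (t : ℝ) ^ (-(5 / 4) : ℝ), fun S hS => ?_⟩
  rw [← Finset.sum_fiberwise_of_maps_to (g := fun p : ℕ => orderOf (b : ZMod p))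
    (t := S.image (fun p : ℕ => orderOf (b : ZMod p))) (fun p hp => Finset.mem_image_of_mem _ hp)]
  have h1 : ∀ t ∈ S.image (fun p : ℕ => orderOf (b : ZMod p)),
      ∑ p ∈ S with orderOf (b : ZMod p) = t, (orderOf (b : ZMod p) : ℝ) ^ (-(9 / 4) : ℝ) ≤
        b * (t : ℝ) ^ (-(5 / 4) : ℝ) := by
    intro t ht
    obtain ⟨q, hq, rfl⟩ := Finset.mem_image.1 ht
    have htpos := ord_pos b q (hS q hq).1.one_lt.le (hS q hq).2
    set t := orderOf (b : ZMod q)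
    have ht' : (0 : ℝ) < t := by exact_mod_cast htpos
    rw [Finset.sum_congr rfl (g := fun _ => (t : ℝ) ^ (-(9 / 4) : ℝ))
      (fun p hp => by rw [(Finset.mem_filter.1 hp).2]), Finset.sum_const, nsmul_eq_mul]
    have hc := card_fiber b t hb htpos (S.filter (fun p => orderOf (b : ZMod p) = t))
      (fun p hp => ⟨(hS p (Finset.mem_filter.1 hp).1).1, (Finset.mem_filter.1 hp).2⟩)
    have hc' : ((S.filter (fun p => orderOf (b : ZMod p) = t)).card : ℝ) ≤ b * t := by
      exact_mod_cast hc
    calc _ ≤ (b * t : ℝ) * (t : ℝ) ^ (-(9 / 4) : ℝ) :=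
          mul_le_mul_of_nonneg_right hc' (by positivity)
      _ = b * ((t : ℝ) ^ (1 : ℝ) * (t : ℝ) ^ (-(9 / 4) : ℝ)) := by rw [Real.rpow_one]; ring
      _ = _ := by rw [← Real.rpow_add ht']; norm_num
  refine (Finset.sum_le_sum h1).trans ?_
  rw [← Finset.mul_sum]
  apply mul_le_mul_of_nonneg_left _ (by positivity)
  exact hsum.sum_le_tsum _ (fun i _ => by positivity)

lemma split_bound (P t : ℝ) (hP : 0 < P) (ht : 0 < t) :
    P ^ (-(7 / 8) : ℝ) * t ^ (-(1 / 2) : ℝ) ≤ P ^ (-(9 / 8) : ℝ) + t ^ (-(9 / 4) : ℝ) := by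
  have e1 : 0 ≤ P ^ (-(9 / 8) : ℝ) := by positivity
  have e2 : 0 ≤ t ^ (-(9 / 4) : ℝ) := by positivity
  rcases le_total P (t ^ (2 : ℝ)) with h | h
  · have h1 := Real.rpow_le_rpow_of_nonpos hP h (show (-(1 / 4) : ℝ) ≤ 0 by norm_num)
    rw [← Real.rpow_mul ht.le] at h1
    norm_num at h1
    have : P ^ (-(7 / 8) : ℝ) * t ^ (-(1 / 2) : ℝ) ≤ P ^ (-(7 / 8) : ℝ) * P ^ (-(1 / 4) : ℝ) := by
      apply mul_le_mul_of_nonneg_left _ (by positivity)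
      convert h1 using 2
    rw [← Real.rpow_add hP] at this
    norm_num at this e1 e2 ⊢
    linarith
  · have h1 := Real.rpow_le_rpow_of_nonpos (by positivity) h (show (-(7 / 8) : ℝ) ≤ 0 by norm_num)
    rw [← Real.rpow_mul ht.le] at h1
    have : P ^ (-(7 / 8) : ℝ) * t ^ (-(1 / 2) : ℝ) ≤ t ^ (2 * -(7 / 8) : ℝ) * t ^ (-(1 / 2) : ℝ) := by
      apply mul_le_mul_of_nonneg_right h1 (by positivity)
    rw [← Real.rpow_add ht] at this
    norm_num at this e1 e2 ⊢
    linarith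

lemma sum_gcd (M t : ℕ) (hM : M ≠ 0) (ht : 1 ≤ t) :
    ∑ e ∈ M.divisors, (Nat.gcd e t : ℝ) / e ≤ t.divisors.card * ∑ c ∈ M.divisors, (c : ℝ)⁻¹ := by
  rw [← Finset.sum_fiberwise_of_maps_to (g := fun e : ℕ => Nat.gcd e t)
    (t := t.divisors) (fun e _ => Nat.mem_divisors.2 ⟨Nat.gcd_dvd_right _ _, by omega⟩),
    ← nsmul_eq_mul]
  apply Finset.sum_le_card_nsmul
  intro a ha
  have ha0 : 0 < a := Nat.pos_of_mem_divisors ha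
  refine le_trans (le_of_eq ?_) (sum_quot (M.divisors.filter (fun e => Nat.gcd e t = a)) M.divisors a
    (fun c => (c : ℝ)⁻¹) (fun x => by positivity) ?_)
  · apply Finset.sum_congr rfl
    intro e he
    rw [Finset.mem_filter] at he
    have hae : a ∣ e := he.2 ▸ Nat.gcd_dvd_left _ _
    rw [he.2, Nat.cast_div hae (by positivity), inv_div]
  · intro e he
    rw [Finset.mem_filter, Nat.mem_divisors] at he
    have hae : a ∣ e := he.2 ▸ Nat.gcd_dvd_left _ _
    exact ⟨hae, Nat.mem_divisors.2 ⟨(Nat.div_dvd_of_dvd hae).trans he.1.1, hM⟩⟩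

/-- the pointwise bound for the terms, by the largest prime factor of `d` -/
lemma term_bound (b g P e : ℕ) (hg : 1 ≤ g) (hP : P.Prime) (he : 1 ≤ e) (hPe : ¬ P ∣ e)
    (hcop : Nat.Coprime (P * e) b) (hcop' : Nat.Coprime g b) :
    (1 : ℝ) / (Nat.lcm (P * e * g) (orderOf (b : ZMod (P * e * g))) : ℕ) ≤
      (1 / (P * (orderOf (b : ZMod P) : ℝ))) *
        ((Nat.gcd e (orderOf (b : ZMod P)) : ℝ) / e) := by
  have hPb : Nat.Coprime P b := hcop.coprime_mul_right
  have hpos := ord_pos b (P * e * g) (Nat.mul_pos (Nat.mul_pos hP.pos he) hg)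
    (Nat.Coprime.mul_left hcop hcop')
  have htd : orderOf (b : ZMod P) ∣ orderOf (b : ZMod (P * e * g)) :=
    ord_dvd b _ _ ((dvd_mul_right P e).mul_right g)
  have htpos := ord_pos b P hP.one_lt.le hPb
  have htP : orderOf (b : ZMod P) ∣ P - 1 := by
    have : Fact P.Prime := ⟨hP⟩
    apply ZMod.orderOf_dvd_card_sub_one
    rw [Ne, ZMod.natCast_eq_zero_iff]
    exact (Nat.Prime.coprime_iff_not_dvd hP).1 hPb
  set t := orderOf (b : ZMod P) with ht
  set T := orderOf (b : ZMod (P * e * g)) with hT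
  have hPt : ¬ P ∣ t := by
    intro h
    have := Nat.le_of_dvd (by have := hP.two_le; omega) (h.trans htP)
    have := hP.two_le
    omega
  have hLpos : 0 < Nat.lcm (P * e * g) T :=
    Nat.lcm_pos (Nat.mul_pos (Nat.mul_pos hP.pos he) hg) hpos
  have hd : P * Nat.lcm e t ∣ Nat.lcm (P * e * g) T := by
    apply Nat.Coprime.mul_dvd_of_dvd_of_dvd
    · rw [Nat.Prime.coprime_iff_not_dvd hP]
      intro h
      rcases (Nat.Prime.dvd_mul hP).1 (h.trans (Nat.lcm_dvd_mul e t)) with h | h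
      · exact hPe h
      · exact hPt h
    · exact ((dvd_mul_right P e).mul_right g).trans (Nat.dvd_lcm_left _ _)
    · apply Nat.lcm_dvd
      · exact ((dvd_mul_left e P).mul_right g).trans (Nat.dvd_lcm_left _ _)
      · exact htd.trans (Nat.dvd_lcm_right _ _)
  have hle := Nat.le_of_dvd hLpos hd
  have hle' : (P : ℝ) * (Nat.lcm e t : ℕ) ≤ (Nat.lcm (P * e * g) T : ℕ) := by exact_mod_cast hle
  have hlpos : (0 : ℝ) < (Nat.lcm e t : ℕ) := by exact_mod_cast Nat.lcm_pos he htpos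
  have hP0 : (0 : ℝ) < P := by exact_mod_cast hP.pos
  have he0 : (0 : ℝ) < e := by exact_mod_cast he
  have ht0 : (0 : ℝ) < t := by exact_mod_cast htpos
  have hgl : (Nat.gcd e t : ℝ) * (Nat.lcm e t : ℕ) = e * t := by
    exact_mod_cast Nat.gcd_mul_lcm e t
  calc (1 : ℝ) / (Nat.lcm (P * e * g) T : ℕ) ≤ 1 / (P * (Nat.lcm e t : ℕ)) :=
        one_div_le_one_div_of_le (by positivity) hle'
    _ = _ := by
      field_simp
      linarith

lemma summable_main (b g : ℕ) (hb : 2 ≤ b) (hg : 1 ≤ g) (hcop : Nat.Coprime g b) (f : ℕ → ℝ)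
    (hf : f = fun d => if 1 ≤ d ∧ Nat.Coprime d b then
        ((ArithmeticFunction.moebius d : ℤ) : ℝ) /
          ((Nat.lcm (d * g) (orderOf (b : ZMod (d * g))) : ℕ) : ℝ) else 0) :
    Summable (fun d => |f d|) := by
  obtain ⟨C1, hC1, hdiv⟩ := sum_inv_divisors
  obtain ⟨C2, hord⟩ := sum_ord b hb
  have hsum : Summable (fun t : ℕ => (t : ℝ) ^ (-(9 / 8) : ℝ)) :=
    Real.summable_nat_rpow.2 (by norm_num)
  -- bound of a block
  have hblock : ∀ P : ℕ, P.Prime → Nat.Coprime P b →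
      ∑ e ∈ (primorial P).divisors, (1 / (P * (orderOf (b : ZMod P) : ℝ))) *
        ((Nat.gcd e (orderOf (b : ZMod P)) : ℝ) / e) ≤
      2 * C1 * ((P : ℝ) ^ (-(9 / 8) : ℝ) + (orderOf (b : ZMod P) : ℝ) ^ (-(9 / 4) : ℝ)) := by
    intro P hP hPb
    have htpos := ord_pos b P hP.one_lt.le hPb
    set t := orderOf (b : ZMod P)
    have hP0 : (0 : ℝ) < P := by exact_mod_cast hP.pos
    have ht0 : (0 : ℝ) < t := by exact_mod_cast htpos
    rw [← Finset.mul_sum]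
    have h1 := sum_gcd (primorial P) t (primorial_ne_zero P) htpos
    have h2 := hdiv P hP.one_lt.le
    have h3 := card_div_le t
    have h4 : ∑ e ∈ (primorial P).divisors, (Nat.gcd e t : ℝ) / e ≤
        (2 * Real.sqrt t) * (C1 * (P : ℝ) ^ (1 / 8 : ℝ)) := by
      refine h1.trans (mul_le_mul h3 h2 ?_ (by positivity))
      exact Finset.sum_nonneg (fun i _ => by positivity)
    have e1 : (P : ℝ) ^ (-(7 / 8) : ℝ) = 1 / P * (P : ℝ) ^ (1 / 8 : ℝ) := by
      rw [one_div (P : ℝ), ← Real.rpow_neg_one, ← Real.rpow_add hP0]; norm_num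
    have e2 : (t : ℝ) ^ (-(1 / 2) : ℝ) = 1 / t * Real.sqrt t := by
      rw [Real.sqrt_eq_rpow, one_div (t : ℝ), ← Real.rpow_neg_one, ← Real.rpow_add ht0]; norm_num
    calc _ ≤ (1 / (P * (t : ℝ))) * ((2 * Real.sqrt t) * (C1 * (P : ℝ) ^ (1 / 8 : ℝ))) :=
          mul_le_mul_of_nonneg_left h4 (by positivity)
      _ = 2 * C1 * ((P : ℝ) ^ (-(7 / 8) : ℝ) * (t : ℝ) ^ (-(1 / 2) : ℝ)) := by
          rw [e1, e2]; field_simp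
      _ ≤ _ := mul_le_mul_of_nonneg_left (split_bound _ _ hP0 ht0) (by positivity)
  apply summable_of_sum_range_le
    (c := |f 1| + 2 * C1 * ((∑' t : ℕ, (t : ℝ) ^ (-(9 / 8) : ℝ)) + C2)) (fun n => abs_nonneg _)
  intro N
  -- relevant terms
  let S := (Finset.range N).filter (fun d => 1 < d ∧ Squarefree d ∧ Nat.Coprime d b)
  have hS : ∑ d ∈ Finset.range N, |f d| ≤ |f 1| + ∑ d ∈ S, |f d| := by
    have : ∑ d ∈ Finset.range N, |f d| ≤ ∑ d ∈ insert 1 S, |f d| := by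
      rw [← Finset.sum_filter_ne_zero]
      apply Finset.sum_le_sum_of_subset_of_nonneg _ (fun _ _ _ => abs_nonneg _)
      intro d hdf
      obtain ⟨hd, hne⟩ := Finset.mem_filter.1 hdf
      rw [Finset.mem_insert, or_iff_not_imp_left]
      intro hd1
      have hfd : f d ≠ 0 := abs_ne_zero.1 hne
      rw [hf] at hfd
      simp only [ne_eq, ite_eq_right_iff, not_forall] at hfd
      obtain ⟨h1, h2⟩ := hfd
      refine Finset.mem_filter.2 ⟨hd, by omega, ?_, h1.2⟩
      rw [← ArithmeticFunction.moebius_ne_zero_iff_squarefree]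
      intro h0
      exact h2 (by simp [h0])
    refine this.trans (le_of_eq (Finset.sum_insert ?_))
    simp [S]
  refine hS.trans (add_le_add_right ?_ _)
  let mp : ℕ → ℕ := fun d => d.primeFactors.sup id
  have hmp : ∀ d ∈ S, mp d ∈ d.primeFactors ∧ ∀ q ∈ d.primeFactors, q ≤ mp d := by
    intro d hd
    have h1 : 1 < d := (Finset.mem_filter.1 hd).2.1
    have hne : d.primeFactors.Nonempty := Nat.nonempty_primeFactors.2 h1
    obtain ⟨x, hx, hx2⟩ := Finset.exists_mem_eq_sup d.primeFactors hne id
    refine ⟨?_, fun q hq => Finset.le_sup (f := id) hq⟩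
    change d.primeFactors.sup id ∈ _
    rw [hx2]; exact hx
  rw [← Finset.sum_fiberwise_of_maps_to (g := mp) (t := S.image mp)
    (fun p hp => Finset.mem_image_of_mem _ hp)]
  have himg : ∀ P ∈ S.image mp, P.Prime ∧ Nat.Coprime P b := by
    intro P hP
    obtain ⟨d, hd, rfl⟩ := Finset.mem_image.1 hP
    have h1 := (hmp d hd).1
    exact ⟨Nat.prime_of_mem_primeFactors h1,
      (Finset.mem_filter.1 hd).2.2.2.coprime_dvd_left (Nat.dvd_of_mem_primeFactors h1)⟩
  have hfib : ∀ P ∈ S.image mp, ∑ d ∈ S with mp d = P, |f d| ≤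
      2 * C1 * ((P : ℝ) ^ (-(9 / 8) : ℝ) + (orderOf (b : ZMod P) : ℝ) ^ (-(9 / 4) : ℝ)) := by
    intro P hP
    obtain ⟨hPp, hPb⟩ := himg P hP
    refine le_trans ?_ (hblock P hPp hPb)
    have hstr : ∀ d ∈ S.filter (fun d => mp d = P), P ∣ d ∧ ¬ P ∣ d / P ∧
        d / P ∈ (primorial P).divisors := by
      intro d hd
      rw [Finset.mem_filter] at hd
      obtain ⟨hdS, hdP⟩ := hd
      have h1 := hmp d hdS
      rw [hdP] at h1
      have hPd : P ∣ d := Nat.dvd_of_mem_primeFactors h1.1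
      have hsq : Squarefree d := (Finset.mem_filter.1 hdS).2.2.1
      refine ⟨hPd, ?_, ?_⟩
      · intro h
        have h5 : P * P ∣ d := by
          have := Nat.mul_dvd_mul_left P h
          rwa [Nat.mul_div_cancel' hPd] at this
        exact hPp.one_lt.ne' (Nat.isUnit_iff.1 (hsq P h5))
      · refine Nat.mem_divisors.2 ⟨(Nat.div_dvd_of_dvd hPd).trans ?_, primorial_ne_zero P⟩
        rw [← Nat.prod_primeFactors_of_squarefree hsq, primorial_eq_prod_primesLE]
        apply Finset.prod_dvd_prod_of_subset
        intro q hq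
        exact Nat.mem_primesLE.2 ⟨h1.2 q hq, Nat.prime_of_mem_primeFactors hq⟩
    refine le_trans (Finset.sum_le_sum ?_) (sum_quot (S.filter (fun d => mp d = P)) _ P
      (fun e => (1 / (P * (orderOf (b : ZMod P) : ℝ))) *
        ((Nat.gcd e (orderOf (b : ZMod P)) : ℝ) / e)) (fun x => by positivity)
      (fun d hd => ⟨(hstr d hd).1, (hstr d hd).2.2⟩))
    intro d hd
    obtain ⟨hPd, hnd, hmem⟩ := hstr d hd
    have hdS := (Finset.mem_filter.1 (Finset.mem_filter.1 hd).1).2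
    obtain ⟨e, rfl⟩ := hPd
    rw [Nat.mul_div_cancel_left _ hPp.pos] at hnd hmem ⊢
    refine le_trans ?_ (term_bound b g P e hg hPp (Nat.pos_of_mem_divisors hmem) hnd
      hdS.2.2 hcop)
    rw [hf]
    simp only
    rw [if_pos ⟨by omega, hdS.2.2⟩, abs_div, Nat.abs_cast]
    apply div_le_div_of_nonneg_right _ (by positivity)
    exact_mod_cast ArithmeticFunction.abs_moebius_le_one
  refine (Finset.sum_le_sum hfib).trans ?_
  rw [← Finset.mul_sum, Finset.sum_add_distrib]
  apply mul_le_mul_of_nonneg_left _ (by positivity)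
  exact add_le_add (hsum.sum_le_tsum _ (fun i _ => by positivity)) (hord _ himg)

lemma tendsto_div (L : ℕ) (hL : 1 ≤ L) :
    Tendsto (fun N : ℕ => ((N / L : ℕ) : ℝ) / N) atTop (nhds (1 / (L : ℝ))) := by
  have h := (tendsto_nat_floor_mul_div_atTop (R := ℝ) (a := 1 / (L : ℝ)) (by positivity)).comp
    (tendsto_natCast_atTop_atTop (R := ℝ))
  refine h.congr (fun N => ?_)
  simp only [Function.comp]
  rw [one_div, inv_mul_eq_div, Nat.floor_div_natCast, Nat.floor_natCast]

theorem Tgb_density (b g : ℕ) (hb : 2 ≤ b) (hg : 1 ≤ g) (hcop : Nat.Coprime g b) :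
    let L : ℕ → ℕ := fun x => Nat.lcm x (orderOf (b : ZMod x))
    let f : ℕ → ℝ := fun d =>
      if 1 ≤ d ∧ Nat.Coprime d b then
        ((ArithmeticFunction.moebius d : ℤ) : ℝ) / (L (d * g) : ℝ) else 0
    Summable (fun d => |f d|) ∧
      Tendsto
        (fun N : ℕ =>
          (((Finset.Icc 1 N).filter
              (fun k => Nat.gcd ((b ^ k - 1) / (b - 1)) k = g)).card : ℝ) / (N : ℝ))
        atTop (nhds (∑' d, f d)) := by
  intro L f
  have hs : Summable (fun d => |f d|) := summable_main b g hb hg hcop f rfl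
  refine ⟨hs, ?_⟩
  have hLpos : ∀ d : ℕ, 1 ≤ d ∧ Nat.Coprime d b → 1 ≤ L (d * g) := by
    intro d hd
    exact Nat.lcm_pos (Nat.mul_pos hd.1 hg)
      (ord_pos b _ (Nat.mul_pos hd.1 hg) (Nat.Coprime.mul_left hd.2 hcop))
  let F : ℕ → ℕ → ℝ := fun N d => if 1 ≤ d ∧ Nat.Coprime d b then
    ((ArithmeticFunction.moebius d : ℤ) : ℝ) * (((N / L (d * g) : ℕ) : ℝ) / N) else 0
  have hF : ∀ N : ℕ, (((Finset.Icc 1 N).filter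
      (fun k => Nat.gcd ((b ^ k - 1) / (b - 1)) k = g)).card : ℝ) / (N : ℝ) = ∑' d, F N d := by
    intro N
    rw [tsum_eq_sum (s := Finset.range (N + 1))]
    · have h := congrArg (fun z : ℤ => (z : ℝ)) (count_eq b g N hb hg hcop)
      simp only [Int.cast_natCast] at h
      rw [h, Int.cast_sum, Finset.sum_div]
      apply Finset.sum_congr rfl
      intro d _
      by_cases hd : 1 ≤ d ∧ Nat.Coprime d b
      · simp only [F]
        rw [if_pos hd, if_pos hd, Int.cast_mul, Int.cast_natCast, mul_div_assoc]
      · simp only [F]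
        rw [if_neg hd, if_neg hd, Int.cast_zero, zero_div]
    · intro d hd
      simp only [F]
      split_ifs with h
      · have h1 : d * g ≤ L (d * g) := Nat.le_of_dvd (hLpos d h) (Nat.dvd_lcm_left _ _)
        have h2 : d ≤ d * g := Nat.le_mul_of_pos_right _ hg
        rw [Finset.mem_range] at hd
        rw [Nat.div_eq_of_lt (by omega)]
        simp
      · rfl
  simp_rw [hF]
  apply tendsto_tsum_of_dominated_convergence hs
  · intro d
    simp only [F, f]
    split_ifs with h
    · have := (tendsto_div (L (d * g)) (hLpos d h)).const_mul
        ((ArithmeticFunction.moebius d : ℤ) : ℝ)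
      rwa [mul_one_div] at this
    · exact tendsto_const_nhds
  · filter_upwards [eventually_ge_atTop 1] with N hN d
    simp only [F, f]
    split_ifs with h
    · rw [Real.norm_eq_abs, abs_mul, abs_div ((ArithmeticFunction.moebius d : ℤ) : ℝ),
        div_eq_mul_inv |((ArithmeticFunction.moebius d : ℤ) : ℝ)|]
      apply mul_le_mul_of_nonneg_left _ (abs_nonneg _)
      have hN' : (0 : ℝ) < N := by exact_mod_cast hN
      have hL' : (0 : ℝ) < L (d * g) := by exact_mod_cast hLpos d h
      rw [abs_of_nonneg (by positivity), Nat.abs_cast, div_le_iff₀ hN', inv_mul_eq_div]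
      exact Nat.cast_div_le
    · simp
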